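/- arXiv:2008.08392 — 4 statements merged into one kernel-verified Lean document; each statement's English description precedes it below -/
import Mathlib

section
/- Let r ∈ M^∨ be primitive with B(r,r) > 0. Then σ_r(M) = M if and only if there exists a positive integer d such that B(r,r) = 2/d and either ord(r) = d or 2·ord(r) = d. -/
/-- For an even integral lattice `M` (a free finite-rank ℤ-submodule
spanning a ℚ-vector space `V` with nondegenerate symmetric bilinear form `B` which
is integral and even on `M`), and a primitive vector `r` of the dual lattice with
`B(r,r) > 0`: the reflection `σ_r` satisfies `σ_r(M) = M` if and only if there is a
positive integer `d` with `B(r,r) = 2/d` and `ord(r) = d` or `2·ord(r) = d`. -/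
theorem statement1 {V : Type*} [AddCommGroup V] [Module ℚ V] [FiniteDimensional ℚ V]
    (B : LinearMap.BilinForm ℚ V)
    (hB_symm : ∀ x y : V, B x y = B y x)
    (hB_nondeg : B.Nondegenerate)
    (M : Submodule ℤ V)
    (hM_free : Module.Free ℤ M) (hM_fin : Module.Finite ℤ M)
    (hM_span : Submodule.span ℚ (M : Set V) = ⊤)
    (hM_int : ∀ x ∈ M, ∀ y ∈ M, ∃ n : ℤ, B x y = (n : ℚ))
    (hM_even : ∀ x ∈ M, ∃ n : ℤ, B x x = 2 * (n : ℚ))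
    (r : V)
    (hr_dual : ∀ m ∈ M, ∃ n : ℤ, B r m = (n : ℚ))
    (hr_prim : ¬ ∃ (k : ℤ) (y : V), 2 ≤ k ∧ (∀ m ∈ M, ∃ n : ℤ, B y m = (n : ℚ)) ∧ r = k • y)
    (hr_pos : 0 < B r r) :
    ((fun x => x - (2 * B r x / B r r) • r) '' (M : Set V) = (M : Set V)) ↔
      ∃ d : ℕ, 0 < d ∧ B r r = 2 / (d : ℚ) ∧
        (addOrderOf (Submodule.Quotient.mk (p := M) r) = d ∨
          2 * addOrderOf (Submodule.Quotient.mk (p := M) r) = d) := by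
  have key : ∃ m ∈ M, B r m = 1 := by
    let S : Ideal ℤ :=
      { carrier := {n : ℤ | ∃ m ∈ M, B r m = (n : ℚ)}
        add_mem' := by
          rintro a b ⟨m, hm, h⟩ ⟨m', hm', h'⟩
          exact ⟨m + m', M.add_mem hm hm', by rw [map_add, h, h']; push_cast; rfl⟩
        zero_mem' := ⟨0, M.zero_mem, by simp⟩
        smul_mem' := by
          rintro c a ⟨m, hm, h⟩
          exact ⟨c • m, M.smul_mem c hm, by rw [map_zsmul, h]; simp⟩ }
    obtain ⟨g, hg⟩ := (IsPrincipalIdealRing.principal S).principal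
    have hdiv : ∀ m ∈ M, ∃ n : ℤ, B r m = (g : ℚ) * n := by
      intro m hm
      obtain ⟨n, hn⟩ := hr_dual m hm
      have h1 : n ∈ S := ⟨m, hm, hn⟩
      rw [hg] at h1
      obtain ⟨c, hc⟩ := Ideal.mem_span_singleton.1 h1
      exact ⟨c, by rw [hn, hc]; push_cast; rfl⟩
    have hno : ∀ k : ℤ, 2 ≤ k → ¬ k ∣ g := by
      rintro k hk ⟨c, hc⟩
      have hk0 : (k : ℚ) ≠ 0 := by
        have : k ≠ 0 := by omega
        exact_mod_cast this
      refine hr_prim ⟨k, (k : ℚ)⁻¹ • r, hk, ?_, ?_⟩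
      · intro m hm
        obtain ⟨n, hn⟩ := hdiv m hm
        refine ⟨c * n, ?_⟩
        rw [map_smul, LinearMap.smul_apply, hn, hc, smul_eq_mul]
        push_cast
        field_simp
      · rw [← Int.cast_smul_eq_zsmul ℚ, smul_smul, mul_inv_cancel₀ hk0, one_smul]
    have hu : g = 1 ∨ g = -1 := by
      have h0 : g ≠ 0 := by
        rintro rfl
        exact hno 2 le_rfl (dvd_zero _)
      have h1 := hno |g|
      have h2 : |g| ∣ g := (abs_dvd g g).2 dvd_rfl
      by_contra hc
      apply h1 _ h2
      rcases abs_cases g with h | h <;> omega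
    have h1 : (1 : ℤ) ∈ S := by
      rw [hg]
      refine Ideal.mem_span_singleton.2 ?_
      rcases hu with rfl | rfl <;> simp
    obtain ⟨m, hm, h⟩ := h1
    exact ⟨m, hm, by simpa using h⟩
  have hn0 : B r r ≠ 0 := hr_pos.ne'
  have hord : ∀ n : ℕ, addOrderOf (Submodule.Quotient.mk (p := M) r) ∣ n ↔ (n : ℚ) • r ∈ M := by
    intro n
    rw [addOrderOf_dvd_iff_nsmul_eq_zero, ← Submodule.Quotient.mk_smul,
      Submodule.Quotient.mk_eq_zero, Nat.cast_smul_eq_nsmul]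
  constructor
  · intro h
    obtain ⟨m, hm, hm1⟩ := key
    have h1 : m - (2 * B r m / B r r) • r ∈ M := by
      have : m - (2 * B r m / B r r) • r ∈ (M : Set V) := by
        rw [← h]
        exact ⟨m, hm, rfl⟩
      exact this
    have h2 : (2 / B r r) • r ∈ M := by
      have := M.sub_mem hm h1
      rw [hm1] at this
      simpa using this
    obtain ⟨z, hz⟩ := hM_int _ h2 _ hm
    rw [map_smul, LinearMap.smul_apply, hm1, smul_eq_mul, mul_one] at hz
    have hzpos : 0 < z := by
      have : (0 : ℚ) < z := by rw [← hz]; positivity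
      exact_mod_cast this
    lift z to ℕ using hzpos.le with d
    have hd : 0 < d := by exact_mod_cast hzpos
    have hdq : (d : ℚ) ≠ 0 := by exact_mod_cast hd.ne'
    simp only [Int.cast_natCast] at hz
    have hB : B r r = 2 / (d : ℚ) := by
      rw [← hz]; field_simp
    refine ⟨d, hd, hB, ?_⟩
    rw [hz] at h2
    obtain ⟨k, hk⟩ := (hord d).2 h2
    have h3 := (hord _).1 (dvd_refl (addOrderOf (Submodule.Quotient.mk (p := M) r)))
    generalize addOrderOf (Submodule.Quotient.mk (p := M) r) = n at *
    obtain ⟨w, hw⟩ := hr_dual _ h3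
    rw [map_smul, smul_eq_mul, hB, hk] at hw
    have hkw : (k : ℤ) * w = 2 := by
      have hn : (n : ℚ) ≠ 0 := by
        rintro h
        apply hdq
        rw [hk]; push_cast; rw [h, zero_mul]
      have hk' : (k : ℚ) ≠ 0 := by
        rintro h
        apply hdq
        rw [hk]; push_cast; rw [h, mul_zero]
      have : (k : ℚ) * w = 2 := by
        rw [← hw]; push_cast; field_simp
      exact_mod_cast this
    have hk2 : k ∣ 2 := by
      have : (k : ℤ) ∣ 2 := ⟨w, hkw.symm⟩
      exact_mod_cast this
    rcases (Nat.dvd_prime Nat.prime_two).1 hk2 with rfl | rfl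
    · left; omega
    · right; omega
  · rintro ⟨d, hd, hB, ho⟩
    have hdq : (d : ℚ) ≠ 0 := by exact_mod_cast hd.ne'
    have hdr : (d : ℚ) • r ∈ M := by
      rw [← hord]
      rcases ho with h | h
      · rw [h]
      · exact ⟨2, by omega⟩
    have hmem : ∀ x ∈ M, x - (2 * B r x / B r r) • r ∈ M := by
      intro x hx
      obtain ⟨n, hn⟩ := hr_dual x hx
      have : (2 * B r x / B r r) • r = n • ((d : ℚ) • r) := by
        rw [← Int.cast_smul_eq_zsmul ℚ, smul_smul, hn, hB]
        congr 1
        field_simp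
      rw [this]
      exact M.sub_mem hx (M.smul_mem _ hdr)
    apply Set.Subset.antisymm
    · rintro _ ⟨x, hx, rfl⟩
      exact hmem x hx
    · intro x hx
      refine ⟨_, hmem x hx, ?_⟩
      have : 2 * B r (x - (2 * B r x / B r r) • r) / B r r = -(2 * B r x / B r r) := by
        rw [map_sub, map_smul, smul_eq_mul]
        field_simp
        ring
      simp only [this]
      module
end

section
/- There are exactly 60 type II classes. -/
open Matrix

noncomputable section

/-- Gram matrix of the even lattice `2U(4) ⊕ A₁`. -/
def GramA : Matrix (Fin 5) (Fin 5) ℚ :=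
  !![0,0,0,0,4; 0,0,0,4,0; 0,0,2,0,0; 0,4,0,0,0; 4,0,0,0,0]

/-- The bilinear form on `V = ℚ⁵` with Gram matrix `GramA`. -/
def BA (x y : Fin 5 → ℚ) : ℚ := x ⬝ᵥ GramA.mulVec y

/-- The lattice `M = ℤ⁵ ⊆ ℚ⁵`. -/
def MA : AddSubgroup (Fin 5 → ℚ) where
  carrier := {x | ∀ i, ∃ n : ℤ, x i = (n : ℚ)}
  zero_mem' := fun i => ⟨0, by simp⟩
  add_mem' := by
    intro a b ha hb i
    obtain ⟨n, hn⟩ := ha i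
    obtain ⟨m, hm⟩ := hb i
    exact ⟨n + m, by simp [hn, hm]⟩
  neg_mem' := by
    intro a ha i
    obtain ⟨n, hn⟩ := ha i
    exact ⟨-n, by simp [hn]⟩

/-- The dual lattice `M^∨ = {x ∈ V : B(x,m) ∈ ℤ for all m ∈ M}`. -/
def MAdual : Set (Fin 5 → ℚ) := {x | ∀ m ∈ MA, ∃ n : ℤ, BA x m = (n : ℚ)}

/-- The discriminant group `M^∨/M` lives inside `V/M`. -/
abbrev QA := (Fin 5 → ℚ) ⧸ MA

/-- The projection `V → V/M`. -/
def pA : (Fin 5 → ℚ) → QA := QuotientAddGroup.mk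

/-- A type II class: an unordered pair `{u+M, −u+M}` of cosets of order 4 in `M^∨/M`
with a representative `u` satisfying `B(u,u) = 1/2`. -/
def IsTypeII (c : Sym2 QA) : Prop :=
  ∃ u : Fin 5 → ℚ, u ∈ MAdual ∧ addOrderOf (pA u) = 4 ∧ BA u u = 1/2 ∧
    c = s(pA u, pA (-u))

/-- The reflection `σ_u(x) = x − 4·B(u,x)·u` (for `B(u,u) = 1/2`). -/
def reflA (u x : Fin 5 → ℚ) : Fin 5 → ℚ := x - (4 * BA u x) • u

/-- A `*`-set: four distinct type II classes such that `σ_u(u') ∈ (u'+M) ∪ (−u'+M)`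
whenever `u, u' ∈ M^∨` have `B(u,u) = B(u',u') = 1/2` and represent cosets of
(possibly equal) classes of the set. -/
def IsStarSet (S : Set (Sym2 QA)) : Prop :=
  S.ncard = 4 ∧ (∀ c ∈ S, IsTypeII c) ∧
  ∀ u u' : Fin 5 → ℚ, u ∈ MAdual → u' ∈ MAdual →
    BA u u = 1/2 → BA u' u' = 1/2 →
    (∃ c ∈ S, pA u ∈ c) → (∃ c' ∈ S, pA u' ∈ c') →
    (reflA u u' - u' ∈ MA ∨ reflA u u' + u' ∈ MA)


/-- The vector of the dual lattice with integer coordinates `(a, b, c, d, e)`. -/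
def phiA (a b c d e : ℤ) : Fin 5 → ℚ :=
  ![(a : ℚ) / 4, (b : ℚ) / 4, (c : ℚ) / 2, (d : ℚ) / 4, (e : ℚ) / 4]

/-- A finite model of the discriminant group. -/
abbrev FA := ZMod 4 × ZMod 4 × ZMod 2 × ZMod 4 × ZMod 4

/-- The residues of an integer vector. -/
def redA (a b c d e : ℤ) : FA := ((a : ZMod 4), (b : ZMod 4), (c : ZMod 2), (d : ZMod 4), (e : ZMod 4))

/-- Map from the finite model to `V/M`. -/
def fA (x : FA) : QA :=
  pA (phiA x.1.cast x.2.1.cast x.2.2.1.cast x.2.2.2.1.cast x.2.2.2.2.cast)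

/-- The square of a residue modulo 2, as a residue modulo 4. -/
def sqA (c : ZMod 2) : ZMod 4 := if c = 0 then 0 else 1

/-- The test for good residues. -/
def goodA (x : FA) : Bool :=
  decide (x.1 * x.2.2.2.2 + x.2.1 * x.2.2.2.1 + sqA x.2.2.1 = 1) &&
    (decide (2 * x.1 ≠ 0) || decide (2 * x.2.1 ≠ 0) || decide (2 * x.2.2.2.1 ≠ 0)
      || decide (2 * x.2.2.2.2 ≠ 0))

theorem mem_MA (x : Fin 5 → ℚ) : x ∈ MA ↔ ∀ i, ∃ n : ℤ, x i = (n : ℚ) := Iff.rfl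

theorem div_int (k a : ℤ) (hk : k ≠ 0) : (∃ n : ℤ, (a : ℚ) / (k : ℚ) = n) ↔ k ∣ a := by
  have hk' : (k : ℚ) ≠ 0 := by exact_mod_cast hk
  constructor
  · rintro ⟨n, hn⟩
    refine ⟨n, ?_⟩
    field_simp at hn
    exact_mod_cast hn
  · rintro ⟨n, rfl⟩
    refine ⟨n, ?_⟩
    push_cast
    field_simp

theorem phi_mem (a b c d e : ℤ) :
    phiA a b c d e ∈ MA ↔ 4 ∣ a ∧ 4 ∣ b ∧ 2 ∣ c ∧ 4 ∣ d ∧ 4 ∣ e := by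
  rw [mem_MA]
  have h4 := fun a => div_int 4 a (by norm_num)
  have h2 := fun a => div_int 2 a (by norm_num)
  push_cast at h4 h2
  simp [phiA, Fin.forall_fin_succ, h4, h2]

theorem phi_eq (a b c d e a' b' c' d' e' : ℤ) :
    pA (phiA a b c d e) = pA (phiA a' b' c' d' e') ↔ redA a b c d e = redA a' b' c' d' e' := by
  have h : -phiA a b c d e + phiA a' b' c' d' e'
      = phiA (a' - a) (b' - b) (c' - c) (d' - d) (e' - e) := by
    funext i
    fin_cases i <;> simp [phiA] <;> ring
  unfold pA
  rw [QuotientAddGroup.eq, h, phi_mem]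
  simp only [redA, Prod.mk.injEq]
  have k4 := fun a b : ℤ => ZMod.intCast_eq_intCast_iff_dvd_sub a b 4
  have k2 := fun a b : ℤ => ZMod.intCast_eq_intCast_iff_dvd_sub a b 2
  push_cast at k4 k2
  simp only [k4, k2]

theorem red_cast (x : FA) :
    redA x.1.cast x.2.1.cast x.2.2.1.cast x.2.2.2.1.cast x.2.2.2.2.cast = x := by
  simp [redA]

theorem f_red (a b c d e : ℤ) : fA (redA a b c d e) = pA (phiA a b c d e) := by
  unfold fA
  rw [phi_eq, red_cast]

theorem f_inj : Function.Injective fA := by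
  intro x y h
  unfold fA at h
  rwa [phi_eq, red_cast, red_cast] at h

theorem phi_neg (a b c d e : ℤ) : -phiA a b c d e = phiA (-a) (-b) (-c) (-d) (-e) := by
  funext i
  fin_cases i <;> simp [phiA] <;> ring

theorem red_neg (a b c d e : ℤ) : -redA a b c d e = redA (-a) (-b) (-c) (-d) (-e) := by
  simp [redA]

theorem BA_eq (x y : Fin 5 → ℚ) :
    BA x y = 4 * (x 0 * y 4 + x 1 * y 3 + x 3 * y 1 + x 4 * y 0) + 2 * (x 2 * y 2) := by
  simp [BA, GramA, Matrix.mulVec, dotProduct, Fin.sum_univ_succ]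
  ring

theorem BA_phi (a b c d e : ℤ) :
    BA (phiA a b c d e) (phiA a b c d e) = 1 / 2 ↔ a * e + b * d + c * c = 1 := by
  rw [BA_eq]
  simp only [phiA]
  simp
  rw [← @Int.cast_inj ℚ]
  push_cast
  constructor <;> intro h <;> linarith

theorem phi_dual (a b c d e : ℤ) : phiA a b c d e ∈ MAdual := by
  intro m hm
  obtain ⟨m0, h0⟩ := hm 0
  obtain ⟨m1, h1⟩ := hm 1
  obtain ⟨m2, h2⟩ := hm 2
  obtain ⟨m3, h3⟩ := hm 3
  obtain ⟨m4, h4⟩ := hm 4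
  refine ⟨a * m4 + b * m3 + c * m2 + d * m1 + e * m0, ?_⟩
  rw [BA_eq, h0, h1, h2, h3, h4]
  simp [phiA]
  ring

theorem dual_phi (u : Fin 5 → ℚ) (hu : u ∈ MAdual) : ∃ a b c d e, u = phiA a b c d e := by
  have key : ∀ i, ∃ n : ℤ, BA u (Pi.single i 1) = n := by
    intro i
    apply hu
    intro j
    by_cases h : j = i
    · subst h
      exact ⟨1, by simp⟩
    · exact ⟨0, by simp [h]⟩
  obtain ⟨a, ha⟩ := key 4
  obtain ⟨b, hb⟩ := key 3
  obtain ⟨c, hc⟩ := key 2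
  obtain ⟨d, hd⟩ := key 1
  obtain ⟨e, he⟩ := key 0
  refine ⟨a, b, c, d, e, ?_⟩
  rw [BA_eq] at ha hb hc hd he
  simp at ha hb hc hd he
  funext i
  fin_cases i <;> simp [phiA] <;> linarith

theorem nsmul_phi (n : ℕ) (a b c d e : ℤ) :
    n • pA (phiA a b c d e) = 0 ↔ 4 ∣ n * a ∧ 4 ∣ n * b ∧ 2 ∣ n * c ∧ 4 ∣ n * d ∧ 4 ∣ n * e := by
  rw [← phi_mem, ← QuotientAddGroup.eq_zero_iff]
  have : phiA (n * a) (n * b) (n * c) (n * d) (n * e) = n • phiA a b c d e := by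
    funext i
    fin_cases i <;> simp [phiA] <;> ring
  rw [this]
  rfl

theorem order_phi (a b c d e : ℤ) :
    addOrderOf (pA (phiA a b c d e)) = 4 ↔ ¬ (2 ∣ a ∧ 2 ∣ b ∧ 2 ∣ d ∧ 2 ∣ e) := by
  constructor
  · intro h hh
    have h2 : 2 • pA (phiA a b c d e) = 0 := by
      rw [nsmul_phi]
      push_cast
      omega
    have := addOrderOf_dvd_of_nsmul_eq_zero h2
    rw [h] at this
    omega
  · intro h
    have : addOrderOf (pA (phiA a b c d e)) = 2 ^ (1 + 1) := by
      apply addOrderOf_eq_prime_pow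
      · rw [nsmul_phi]
        push_cast
        omega
      · rw [nsmul_phi]
        push_cast
        omega
    simpa using this

theorem good_red (a b c d e : ℤ) :
    goodA (redA a b c d e) = true ↔
      4 ∣ a * e + b * d + c * c - 1 ∧ ¬ (2 ∣ a ∧ 2 ∣ b ∧ 2 ∣ d ∧ 2 ∣ e) := by
  have k4 : ∀ a : ℤ, 2 * (a : ZMod 4) = 0 ↔ 2 ∣ a := by
    intro a
    have := ZMod.intCast_zmod_eq_zero_iff_dvd (2 * a) 4
    push_cast at this
    rw [this]
    omega
  have kc : sqA (c : ZMod 2) = (c : ZMod 4) * c := by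
    have h2 := ZMod.intCast_zmod_eq_zero_iff_dvd c 2
    push_cast at h2
    unfold sqA
    simp only [h2]
    split_ifs with h
    · obtain ⟨k, rfl⟩ := h
      have h4 : (4 : ZMod 4) = 0 := rfl
      push_cast
      linear_combination (-(k : ZMod 4) * k) * h4
    · obtain ⟨k, hk⟩ : ∃ k, c = 2 * k + 1 := ⟨c / 2, by omega⟩
      have h4 : (4 : ZMod 4) = 0 := rfl
      rw [hk]
      push_cast
      linear_combination (-(k : ZMod 4) * k - k) * h4
  have hm := ZMod.intCast_zmod_eq_zero_iff_dvd (a * e + b * d + c * c - 1) 4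
  push_cast at hm
  rw [sub_eq_zero] at hm
  rw [← hm]
  simp only [goodA, redA, kc, Bool.and_eq_true, Bool.or_eq_true, decide_eq_true_eq, ne_eq, k4]
  tauto

/-- Lifting when the first coordinate is odd. -/
theorem lift_aux (a e r : ℤ) (h : 4 ∣ a * e + r - 1) (ha : ¬ 2 ∣ a) :
    ∃ a' e' : ℤ, 4 ∣ a' - a ∧ 4 ∣ e' - e ∧ a' * e' + r = 1 := by
  have : 4 ∣ a - 1 ∨ 4 ∣ a + 1 := by omega
  rcases this with ⟨k, hk⟩ | ⟨k, hk⟩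
  · refine ⟨1, 1 - r, by omega, ?_, by ring⟩
    obtain ⟨l, hl⟩ := h
    refine ⟨k * e - l, ?_⟩
    linear_combination e * hk - hl
  · refine ⟨-1, r - 1, by omega, ?_, by ring⟩
    obtain ⟨l, hl⟩ := h
    refine ⟨l - k * e, ?_⟩
    linear_combination hl - e * hk

theorem lift_good (a b c d e : ℤ) (h : 4 ∣ a * e + b * d + c * c - 1)
    (ho : ¬ (2 ∣ a ∧ 2 ∣ b ∧ 2 ∣ d ∧ 2 ∣ e)) :
    ∃ a' b' d' e' : ℤ, 4 ∣ a' - a ∧ 4 ∣ b' - b ∧ 4 ∣ d' - d ∧ 4 ∣ e' - e ∧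
      a' * e' + b' * d' + c * c = 1 := by
  by_cases ha : 2 ∣ a
  · by_cases hb : 2 ∣ b
    · by_cases hd : 2 ∣ d
      · have he : ¬ 2 ∣ e := by tauto
        obtain ⟨e', a', h1, h2, h3⟩ := lift_aux e a (b * d + c * c) (by ring_nf at h ⊢; exact h) he
        exact ⟨a', b, d, e', h2, by simp, by simp, h1, by linarith⟩
      · obtain ⟨d', b', h1, h2, h3⟩ := lift_aux d b (a * e + c * c) (by ring_nf at h ⊢; exact h) hd
        exact ⟨a, b', d', e, by simp, h2, h1, by simp, by linarith⟩
    · obtain ⟨b', d', h1, h2, h3⟩ := lift_aux b d (a * e + c * c) (by ring_nf at h ⊢; exact h) hb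
      exact ⟨a, b', d', e, by simp, h1, h2, by simp, by linarith⟩
  · obtain ⟨a', e', h1, h2, h3⟩ := lift_aux a e (b * d + c * c) (by ring_nf at h ⊢; exact h) ha
    exact ⟨a', b, d, e', h1, by simp, by simp, h2, by linarith⟩

/-- The finite set of pairs `{x, -x}` of good residues. -/
def pairsA : Finset (Sym2 FA) := (Finset.univ.filter (fun x => goodA x = true)).image (fun x => s(x, -x))

theorem pairs_card : pairsA.card = 60 := by
  decide +kernel

theorem typeII_eq : {c : Sym2 QA | IsTypeII c} = Sym2.map fA '' (pairsA : Set (Sym2 FA)) := by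
  ext c
  simp only [Set.mem_ofPred_eq, Set.mem_image, Finset.mem_coe, pairsA, Finset.mem_image,
    Finset.mem_filter, Finset.mem_univ, true_and]
  constructor
  · rintro ⟨u, hu, ho, hB, rfl⟩
    obtain ⟨a, b, c, d, e, rfl⟩ := dual_phi u hu
    rw [order_phi] at ho
    rw [BA_phi] at hB
    refine ⟨_, ⟨redA a b c d e, ?_, rfl⟩, ?_⟩
    · rw [good_red]
      exact ⟨by simp [hB], ho⟩
    · rw [Sym2.map_mk, red_neg, phi_neg, f_red, f_red]
  · rintro ⟨_, ⟨x, hx, rfl⟩, rfl⟩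
    obtain ⟨a, b, c, d, e, rfl⟩ : ∃ a b c d e, x = redA a b c d e :=
      ⟨_, _, _, _, _, (red_cast x).symm⟩
    rw [good_red] at hx
    obtain ⟨a', b', d', e', ha, hb, hd, he, hn⟩ := lift_good a b c d e hx.1 hx.2
    have hr : redA a b c d e = redA a' b' c d' e' := by
      have k4 := fun a b : ℤ => ZMod.intCast_eq_intCast_iff_dvd_sub a b 4
      push_cast at k4
      simp only [redA, Prod.mk.injEq, k4]
      exact ⟨ha, hb, trivial, hd, he⟩
    refine ⟨phiA a' b' c d' e', phi_dual _ _ _ _ _, ?_, ?_, ?_⟩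
    · rw [order_phi]
      have := hx.2
      omega
    · rw [BA_phi]
      exact hn
    · rw [Sym2.map_mk, hr, red_neg, phi_neg, f_red, f_red]

/-- There are exactly 60 type II classes. -/
theorem statement3 : {c : Sym2 QA | IsTypeII c}.ncard = 60 := by
  rw [typeII_eq, Set.ncard_image_of_injective _ (Sym2.map.injective f_inj),
    Set.ncard_coe_finset, pairs_card]

end
end

section
/- Among the 1770 unordered pairs of distinct type II classes, exactly 1320 are contained in no *-set, exactly 360 are contained in exactly one *-set, and the remaining 90 are each contained in exactly three *-sets; in particular no pair is contained in exactly two, or in more than three, *-sets. -/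
open Matrix

noncomputable section

/-- An unordered pair of distinct type II classes. -/
def IsPair (P : Set (Sym2 QA)) : Prop :=
  ∃ c₁ c₂ : Sym2 QA, IsTypeII c₁ ∧ IsTypeII c₂ ∧ c₁ ≠ c₂ ∧ P = {c₁, c₂}

/-- The number of `*`-sets containing a given pair. -/
def nStar (P : Set (Sym2 QA)) : ℕ := {S : Set (Sym2 QA) | IsStarSet S ∧ P ⊆ S}.ncard

/-- Integer coordinates of a dual vector. -/
structure Z6 where
  a : ℤ
  b : ℤ
  c : ℤ
  d : ℤ
  e : ℤ

def tab6 : List Z6 :=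
  [⟨-1, 0, 0, 0, -1⟩, ⟨0, 0, 1, 0, -1⟩, ⟨0, -1, 0, -1, 0⟩, ⟨0, 0, 1, -1, 0⟩,
   ⟨0, -1, 1, 0, 0⟩, ⟨-1, 0, 1, 0, 0⟩, ⟨0, -1, 0, -1, -1⟩, ⟨-1, 0, 0, -1, -1⟩,
   ⟨0, 0, 1, -1, -1⟩, ⟨-1, -1, 0, 0, -1⟩, ⟨-1, 1, 0, 0, -1⟩, ⟨0, -1, 1, 0, -1⟩,
   ⟨0, 1, 1, 0, -1⟩, ⟨-1, 0, 0, 1, -1⟩, ⟨0, 1, 0, 1, -1⟩, ⟨0, 0, 1, 1, -1⟩,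
   ⟨-1, -1, 0, -1, 0⟩, ⟨1, -1, 0, -1, 0⟩, ⟨-1, 0, 1, -1, 0⟩, ⟨1, 0, 1, -1, 0⟩,
   ⟨-1, -1, 1, 0, 0⟩, ⟨1, -1, 1, 0, 0⟩, ⟨0, -1, 0, -1, -2⟩, ⟨0, 0, 1, -1, -2⟩,
   ⟨0, -1, 1, 0, -2⟩, ⟨-1, 0, 0, -2, -1⟩, ⟨0, 0, 1, -2, -1⟩, ⟨-1, -2, 0, 0, -1⟩,
   ⟨0, -2, 1, 0, -1⟩, ⟨-1, 0, 1, -2, 0⟩, ⟨-2, -1, 0, -1, 0⟩, ⟨-2, 0, 1, -1, 0⟩,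
   ⟨-1, -2, 1, 0, 0⟩, ⟨-2, -1, 1, 0, 0⟩, ⟨-1, 1, 0, -1, -2⟩, ⟨-1, -1, 0, 1, -2⟩,
   ⟨1, -1, 0, -2, -1⟩, ⟨1, -2, 0, -1, -1⟩, ⟨-2, 1, 0, -1, -1⟩, ⟨1, -1, 1, -1, -1⟩,
   ⟨-1, 1, 1, -1, -1⟩, ⟨-2, -1, 0, 1, -1⟩, ⟨1, 2, 0, 1, -1⟩, ⟨-1, -1, 1, 1, -1⟩,
   ⟨1, 1, 1, 1, -1⟩, ⟨1, 1, 0, 2, -1⟩, ⟨1, -1, 1, -2, -2⟩, ⟨1, -2, 1, -1, -2⟩,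
   ⟨-1, 2, 1, -1, -2⟩, ⟨-1, -1, 1, 2, -2⟩, ⟨2, -1, 1, -2, -1⟩, ⟨-2, 1, 1, -2, -1⟩,
   ⟨2, -2, 1, -1, -1⟩, ⟨-2, -2, 1, 1, -1⟩, ⟨1, -2, 0, -2, -3⟩, ⟨-2, 1, 0, -3, -2⟩,
   ⟨1, -2, 1, -2, -4⟩, ⟨2, -1, 1, -4, -2⟩, ⟨2, -4, 1, -1, -2⟩, ⟨4, -2, 1, -2, -1⟩]

/-- The adjacency table, one bit for each ordered pair of indices. -/
def table6 : ℕ :=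
  2552433258786930652645301758829314533043150709666685132353713004352153655763321589988692921053590770046787401788010379834646435026587357436738691894002670182292034468069539936761011037431980851789047093961399693772312103200012338331744271737278489138817916962990394791843288514952019160765967564550235578084792126432824760854182575863344372932921715315606165405258405491151661977414560326149414041730449630924055908520494430686580539140339129696270294009130227222169339027046734426539107585478024293889309142858261358652267983158834407326721220703481270433390835220272921434331177371983688931223124686793699574923503524202247817912137885882934190855577045063630369367285302737059444126227616695520510639435096418732706993303257575333906582725077265409522736846978862193721865535467112124546079970033432185313322375459702880114911665441885583654125088442860293981003064754163937895261863093388132485888821621540286965146459645493746685073601170629914979737900018401768321597146668146973582667751852457417747146524780923668520345677375601203659446847882318260425502083585128970422583325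

def rep6 (i : Fin 60) : Z6 := tab6.getD i ⟨0, 0, 0, 0, 0⟩

def adjN (i j : ℕ) : Bool := table6.testBit (60 * i + j)

def adjB (i j : Fin 60) : Bool := adjN i j

def vec6 (x : Z6) : Fin 5 → ℚ := ![x.a / 4, x.b / 4, x.c / 2, x.d / 4, x.e / 4]

def n6 (x y : Z6) : ℤ := x.a * y.e + x.e * y.a + x.b * y.d + x.d * y.b + 2 * (x.c * y.c)

/-- linear combination `s x + t y` -/
def lin6 (s t : ℤ) (x y : Z6) : Z6 :=
  ⟨s * x.a + t * y.a, s * x.b + t * y.b, s * x.c + t * y.c, s * x.d + t * y.d, s * x.e + t * y.e⟩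

/-- membership in the lattice -/
def zero6 (x : Z6) : Bool :=
  x.a % 4 == 0 && x.b % 4 == 0 && x.c % 2 == 0 && x.d % 4 == 0 && x.e % 4 == 0

def adjZ (x y : Z6) : Bool :=
  zero6 (lin6 (-n6 x y) 0 x y) || zero6 (lin6 (-n6 x y) 2 x y)

theorem zero6_iff (x : Z6) : zero6 x = true ↔
    x.a ≡ 0 [ZMOD 4] ∧ x.b ≡ 0 [ZMOD 4] ∧ x.c ≡ 0 [ZMOD 2] ∧ x.d ≡ 0 [ZMOD 4] ∧
      x.e ≡ 0 [ZMOD 4] := by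
  simp [zero6, Int.ModEq, and_assoc]

theorem vec_lin (s t : ℤ) (x y : Z6) :
    vec6 (lin6 s t x y) = (s : ℚ) • vec6 x + (t : ℚ) • vec6 y := by
  funext i
  fin_cases i <;> simp [vec6, lin6] <;> ring

theorem BA_vec (x y : Z6) : BA (vec6 x) (vec6 y) = (n6 x y : ℚ) / 4 := by
  simp [BA, GramA, vec6, n6, dotProduct, mulVec, Fin.sum_univ_five]
  ring

theorem int_div_iff (n k : ℤ) (hk : k ≠ 0) : (∃ m : ℤ, (n : ℚ) / k = m) ↔ n ≡ 0 [ZMOD k] := by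
  have hk' : (k : ℚ) ≠ 0 := by exact_mod_cast hk
  rw [Int.modEq_zero_iff_dvd]
  constructor
  · rintro ⟨m, hm⟩
    refine ⟨m, ?_⟩
    field_simp at hm
    exact_mod_cast hm
  · rintro ⟨m, rfl⟩
    refine ⟨m, ?_⟩
    push_cast
    field_simp

theorem vec_mem (x : Z6) : vec6 x ∈ MA ↔ zero6 x = true := by
  rw [zero6_iff]
  change (∀ i, ∃ n : ℤ, vec6 x i = (n : ℚ)) ↔ _
  have h4 := fun n => int_div_iff n 4 (by norm_num)
  have h2 := fun n => int_div_iff n 2 (by norm_num)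
  simp only [Fin.forall_fin_succ, ← h4, ← h2]
  simp [vec6]

theorem mem_dual (u : Fin 5 → ℚ) : u ∈ MAdual ↔ ∃ x, u = vec6 x := by
  constructor
  · intro h
    have key : ∀ i : Fin 5, ∃ n : ℤ, BA u (Pi.single i 1) = n := by
      intro i
      apply h
      intro j
      by_cases hij : j = i
      · subst hij; exact ⟨1, by simp⟩
      · exact ⟨0, by simp [hij]⟩
    obtain ⟨n0, h0⟩ := key 0
    obtain ⟨n1, h1⟩ := key 1
    obtain ⟨n2, h2⟩ := key 2
    obtain ⟨n3, h3⟩ := key 3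
    obtain ⟨n4, h4⟩ := key 4
    simp [BA, GramA, dotProduct, Fin.sum_univ_five] at h0 h1 h2 h3 h4
    refine ⟨⟨n4, n3, n2, n1, n0⟩, ?_⟩
    funext i
    fin_cases i <;> simp [vec6] <;> linarith
  · rintro ⟨x, rfl⟩ m hm
    obtain ⟨n0, h0⟩ := hm 0
    obtain ⟨n1, h1⟩ := hm 1
    obtain ⟨n2, h2⟩ := hm 2
    obtain ⟨n3, h3⟩ := hm 3
    obtain ⟨n4, h4⟩ := hm 4
    refine ⟨x.a * n4 + x.b * n3 + x.c * n2 + x.d * n1 + x.e * n0, ?_⟩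
    simp [BA, GramA, vec6, dotProduct, mulVec, Fin.sum_univ_five, h0, h1, h2, h3, h4]
    ring

theorem vec6_neg (x : Z6) : -vec6 x = vec6 (lin6 (-1) 0 x x) := by
  rw [vec_lin]; simp

theorem pA_eq (x y : Z6) : pA (vec6 x) = pA (vec6 y) ↔ zero6 (lin6 (-1) 1 x y) = true := by
  rw [← vec_mem, vec_lin]
  unfold pA
  rw [QuotientAddGroup.eq]
  simp

theorem pA_eq_neg (x y : Z6) : pA (vec6 x) = pA (-vec6 y) ↔ zero6 (lin6 1 1 x y) = true := by
  rw [vec6_neg, pA_eq, ← vec_mem, ← vec_mem, ← neg_mem_iff]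
  simp only [vec_lin]
  simp [add_comm]

theorem order_iff (x : Z6) : addOrderOf (pA (vec6 x)) = 4 ↔ zero6 (lin6 2 0 x x) = false := by
  have e2 : (2 : ℕ) • pA (vec6 x) = pA (vec6 (lin6 2 0 x x)) := by
    rw [vec_lin]; simp [two_smul]; rfl
  have e4 : (4 : ℕ) • pA (vec6 x) = pA (vec6 (lin6 4 0 x x)) := by
    rw [vec_lin]
    have : ((4 : ℤ) : ℚ) • vec6 x + ((0 : ℤ) : ℚ) • vec6 x = (4 : ℕ) • vec6 x := by
      funext i; simp
    rw [this]; rfl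
  have z (u : Fin 5 → ℚ) : pA u = 0 ↔ u ∈ MA := QuotientAddGroup.eq_zero_iff u
  have h4 : (4 : ℕ) • pA (vec6 x) = 0 := by
    rw [e4, z, vec_mem, zero6_iff]
    simp [lin6, Int.modEq_zero_iff_dvd]
    omega
  constructor
  · intro h
    by_contra hc
    rw [Bool.not_eq_false, ← vec_mem, ← z, ← e2] at hc
    have := addOrderOf_dvd_of_nsmul_eq_zero hc
    rw [h] at this
    norm_num at this
  · intro h
    have : addOrderOf (pA (vec6 x)) = 2 ^ (1 + 1) := by
      apply addOrderOf_eq_prime_pow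
      · rw [pow_one, e2, z, vec_mem, h]; simp
      · exact h4
    exact this

theorem refl_iff (x y : Z6) :
    (reflA (vec6 x) (vec6 y) - vec6 y ∈ MA ∨ reflA (vec6 x) (vec6 y) + vec6 y ∈ MA) ↔
      adjZ x y = true := by
  have e1 : reflA (vec6 x) (vec6 y) - vec6 y = vec6 (lin6 (-n6 x y) 0 x y) := by
    rw [vec_lin, reflA, BA_vec, mul_div_cancel₀ _ (by norm_num : (4 : ℚ) ≠ 0)]
    funext i
    simp only [Pi.add_apply, Pi.sub_apply, Pi.smul_apply, smul_eq_mul]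
    push_cast
    ring
  have e2 : reflA (vec6 x) (vec6 y) + vec6 y = vec6 (lin6 (-n6 x y) 2 x y) := by
    rw [vec_lin, reflA, BA_vec, mul_div_cancel₀ _ (by norm_num : (4 : ℚ) ≠ 0)]
    funext i
    simp only [Pi.add_apply, Pi.sub_apply, Pi.smul_apply, smul_eq_mul]
    push_cast
    ring
  rw [e1, e2, vec_mem, vec_mem, adjZ, Bool.or_eq_true]

/-- `x` is congruent to `y` up to sign -/
def sim6 (x y : Z6) : Bool := zero6 (lin6 (-1) 1 x y) || zero6 (lin6 1 1 x y)

theorem n6_congr {x y x' y' : Z6} (hx : zero6 (lin6 (-1) 1 x x') = true)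
    (hy : zero6 (lin6 (-1) 1 y y') = true) : n6 x y ≡ n6 x' y' [ZMOD 4] := by
  rw [zero6_iff] at hx hy
  simp only [lin6, Int.modEq_zero_iff_dvd] at hx hy
  obtain ⟨⟨a, ha⟩, ⟨b, hb⟩, ⟨c, hc⟩, ⟨d, hd⟩, ⟨e, he⟩⟩ := hx
  obtain ⟨⟨p, hp⟩, ⟨q, hq⟩, ⟨r, hr⟩, ⟨s, hs⟩, ⟨t, ht⟩⟩ := hy
  obtain ⟨xa, xb, xc, xd, xe⟩ := x
  obtain ⟨ya, yb, yc, yd, ye⟩ := y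
  obtain ⟨xa', xb', xc', xd', xe'⟩ := x'
  obtain ⟨ya', yb', yc', yd', ye'⟩ := y'
  simp only at *
  obtain rfl : xa' = xa + 4 * a := by linarith
  obtain rfl : xb' = xb + 4 * b := by linarith
  obtain rfl : xc' = xc + 2 * c := by linarith
  obtain rfl : xd' = xd + 4 * d := by linarith
  obtain rfl : xe' = xe + 4 * e := by linarith
  obtain rfl : ya' = ya + 4 * p := by linarith
  obtain rfl : yb' = yb + 4 * q := by linarith
  obtain rfl : yc' = yc + 2 * r := by linarith
  obtain rfl : yd' = yd + 4 * s := by linarith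
  obtain rfl : ye' = ye + 4 * t := by linarith
  rw [Int.modEq_iff_dvd]
  refine ⟨xa * t + a * ye + 4 * a * t + xe * p + e * ya + 4 * e * p + xb * s + b * yd + 4 * b * s
    + xd * q + d * yb + 4 * d * q + xc * r + c * yc + 2 * c * r, ?_⟩
  simp only [n6]
  ring

theorem n6_congr8 {x x' : Z6} (hx : zero6 (lin6 (-1) 1 x x') = true) :
    n6 x x ≡ n6 x' x' [ZMOD 8] := by
  rw [zero6_iff] at hx
  simp only [lin6, Int.modEq_zero_iff_dvd] at hx
  obtain ⟨⟨a, ha⟩, ⟨b, hb⟩, ⟨c, hc⟩, ⟨d, hd⟩, ⟨e, he⟩⟩ := hx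
  obtain ⟨xa, xb, xc, xd, xe⟩ := x
  obtain ⟨xa', xb', xc', xd', xe'⟩ := x'
  simp only at *
  obtain rfl : xa' = xa + 4 * a := by linarith
  obtain rfl : xb' = xb + 4 * b := by linarith
  obtain rfl : xc' = xc + 2 * c := by linarith
  obtain rfl : xd' = xd + 4 * d := by linarith
  obtain rfl : xe' = xe + 4 * e := by linarith
  rw [Int.modEq_iff_dvd]
  refine ⟨xa * e + a * xe + 4 * a * e + xb * d + b * xd + 4 * b * d + xc * c + c * c, ?_⟩
  simp only [n6]
  ring

theorem zero_lin_congr {x y x' y' : Z6} {s s' : ℤ} (t : ℤ) (hs : s ≡ s' [ZMOD 4])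
    (hx : zero6 (lin6 (-1) 1 x x') = true) (hy : zero6 (lin6 (-1) 1 y y') = true)
    (h : zero6 (lin6 s t x y) = true) : zero6 (lin6 s' t x' y') = true := by
  have hs2 : s ≡ s' [ZMOD 2] := hs.of_dvd (by norm_num)
  rw [zero6_iff] at *
  have aux : ∀ {p q k : ℤ}, -1 * p + 1 * q ≡ 0 [ZMOD k] → q ≡ p [ZMOD k] := by
    intro p q k h
    have := h.add_right p
    ring_nf at this
    exact this
  obtain ⟨a, b, c, d, e⟩ := hx
  obtain ⟨a', b', c', d', e'⟩ := hy
  obtain ⟨p, q, r, s, t⟩ := h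
  exact ⟨((hs.symm.mul (aux a)).add ((aux a').mul_left _)).trans p,
    ((hs.symm.mul (aux b)).add ((aux b').mul_left _)).trans q,
    ((hs2.symm.mul (aux c)).add ((aux c').mul_left _)).trans r,
    ((hs.symm.mul (aux d)).add ((aux d').mul_left _)).trans s,
    ((hs.symm.mul (aux e)).add ((aux e').mul_left _)).trans t⟩

theorem adj_congr1 {x y x' y' : Z6} (hx : zero6 (lin6 (-1) 1 x x') = true)
    (hy : zero6 (lin6 (-1) 1 y y') = true) (h : adjZ x y = true) : adjZ x' y' = true := by
  have hn := (n6_congr hx hy).neg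
  rw [adjZ, Bool.or_eq_true] at *
  exact h.imp (zero_lin_congr 0 hn hx hy) (zero_lin_congr 2 hn hx hy)

theorem adj_negl {x y : Z6} : adjZ (lin6 (-1) 0 x x) y = adjZ x y := by
  have : ∀ t, lin6 (-n6 (lin6 (-1) 0 x x) y) t (lin6 (-1) 0 x x) y = lin6 (-n6 x y) t x y := by
    intro t; simp only [lin6, n6, Z6.mk.injEq]; refine ⟨?_, ?_, ?_, ?_, ?_⟩ <;> ring
  simp only [adjZ, this]

theorem zero_neg (x : Z6) : zero6 (lin6 (-1) 0 x x) = zero6 x := by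
  rw [Bool.eq_iff_iff, ← vec_mem, ← vec6_neg, neg_mem_iff, vec_mem]

theorem adj_negr {x y : Z6} : adjZ x (lin6 (-1) 0 y y) = adjZ x y := by
  have : ∀ t, lin6 (-n6 x (lin6 (-1) 0 y y)) t x (lin6 (-1) 0 y y) =
      lin6 (-1) 0 (lin6 (-n6 x y) t x y) (lin6 (-n6 x y) t x y) := by
    intro t; simp only [lin6, n6, Z6.mk.injEq]; refine ⟨?_, ?_, ?_, ?_, ?_⟩ <;> ring
  simp only [adjZ, this, zero_neg]

theorem sim_cases {x x' : Z6} (h : sim6 x x' = true) : zero6 (lin6 (-1) 1 x x') = true ∨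
    zero6 (lin6 (-1) 1 (lin6 (-1) 0 x x) x') = true := by
  rw [sim6, Bool.or_eq_true] at h
  refine h.imp id (fun h => ?_)
  convert h using 2
  simp [lin6]

theorem adj_congr {x y x' y' : Z6} (hx : sim6 x x' = true) (hy : sim6 y y' = true)
    (h : adjZ x y = true) : adjZ x' y' = true := by
  rcases sim_cases hx with hx | hx <;> rcases sim_cases hy with hy | hy <;>
    refine adj_congr1 hx hy ?_ <;> simpa only [adj_negl, adj_negr] using h

theorem sim_symm {x y : Z6} (h : sim6 x y = true) : sim6 y x = true := by
  simp only [sim6, Bool.or_eq_true, zero6_iff, lin6, Int.ModEq] at *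
  omega

def cls (x : Z6) : Sym2 QA := s(pA (vec6 x), pA (-vec6 x))

theorem mem_cls (x y : Z6) : pA (vec6 x) ∈ cls y ↔ sim6 x y = true := by
  rw [cls, Sym2.mem_iff, pA_eq, pA_eq_neg, sim6, Bool.or_eq_true]

theorem cls_eq (x y : Z6) : cls x = cls y ↔ sim6 x y = true := by
  constructor
  · intro h
    rw [← mem_cls, ← h]
    simp [cls]
  · intro h
    have hn : ∀ u, pA (-u) = - pA u := fun u => rfl
    rw [← mem_cls, cls, Sym2.mem_iff] at h
    unfold cls
    rcases h with h | h
    · rw [hn, hn, h]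
    · rw [hn] at h
      rw [hn, hn, h, neg_neg, Sym2.eq_swap]

def f6 (i : Fin 60) : Sym2 QA := cls (rep6 i)

theorem rep_sim : ∀ i j : Fin 60, sim6 (rep6 i) (rep6 j) = true → i = j := by
  decide +kernel

theorem f6_inj : Function.Injective f6 := by
  intro i j h
  exact rep_sim i j ((cls_eq _ _).1 h)

theorem rep_good : ∀ i : Fin 60, n6 (rep6 i) (rep6 i) = 2 ∧
    zero6 (lin6 2 0 (rep6 i) (rep6 i)) = false := by
  decide +kernel

def mk6 (a b c d e : ℕ) : Z6 := ⟨a, b, c, d, e⟩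

theorem rep_all : ∀ a : Fin 4, ∀ b : Fin 4, ∀ c : Fin 2, ∀ d : Fin 4, ∀ e : Fin 4,
    n6 (mk6 a b c d e) (mk6 a b c d e) % 8 = 2 →
    zero6 (lin6 2 0 (mk6 a b c d e) (mk6 a b c d e)) = false →
    ∃ i : Fin 60, sim6 (mk6 a b c d e) (rep6 i) = true := by
  decide +kernel

theorem rep_adj : ∀ i j : Fin 60, adjZ (rep6 i) (rep6 j) = adjB i j := by
  decide +kernel

theorem typeII_iff (c : Sym2 QA) : IsTypeII c ↔ ∃ i, f6 i = c := by
  constructor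
  · rintro ⟨u, hu, ho, hB, rfl⟩
    obtain ⟨x, rfl⟩ := (mem_dual u).1 hu
    rw [order_iff] at ho
    rw [BA_vec] at hB
    have hn : n6 x x = 2 := by
      have : (n6 x x : ℚ) = 2 := by linarith
      exact_mod_cast this
    have l4 : ∀ z : ℤ, ∃ k : Fin 4, ((k : ℕ) : ℤ) = z % 4 := fun z =>
      ⟨⟨(z % 4).toNat, by omega⟩, by simp; omega⟩
    have l2 : ∀ z : ℤ, ∃ k : Fin 2, ((k : ℕ) : ℤ) = z % 2 := fun z =>
      ⟨⟨(z % 2).toNat, by omega⟩, by simp; omega⟩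
    obtain ⟨a, ha⟩ := l4 x.a
    obtain ⟨b, hb⟩ := l4 x.b
    obtain ⟨c, hc⟩ := l2 x.c
    obtain ⟨d, hd⟩ := l4 x.d
    obtain ⟨e, he⟩ := l4 x.e
    have hz : zero6 (lin6 (-1) 1 x (mk6 a b c d e)) = true := by
      simp only [zero6_iff, lin6, mk6, ha, hb, hc, hd, he, Int.ModEq]
      omega
    have hs : sim6 x (mk6 a b c d e) = true := by simp [sim6, hz]
    have hp := (mem_cls _ _).2 hs
    have heq := (cls_eq _ _).2 hs
    obtain ⟨i, hi⟩ := rep_all a b c d e (by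
      have := n6_congr8 hz
      rw [hn] at this
      exact this.symm) (by
      rw [Bool.eq_false_iff] at ho ⊢
      intro h
      apply ho
      simp only [zero6_iff, lin6, mk6, ha, hb, hc, hd, he, Int.ModEq] at h ⊢
      omega)
    refine ⟨i, ?_⟩
    change cls _ = cls x
    rw [heq, (cls_eq _ _).2 hi]
  · rintro ⟨i, rfl⟩
    obtain ⟨h1, h2⟩ := rep_good i
    refine ⟨vec6 (rep6 i), (mem_dual _).2 ⟨_, rfl⟩, (order_iff _).2 h2, ?_, rfl⟩
    rw [BA_vec, h1]; norm_num

/-- clique predicate -/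
def clq (s : Finset (Fin 60)) : Prop := ∀ i ∈ s, ∀ j ∈ s, adjB i j = true

instance (s : Finset (Fin 60)) : Decidable (clq s) := by unfold clq; infer_instance

def im6 (s : Finset (Fin 60)) : Set (Sym2 QA) := f6 '' (s : Set (Fin 60))

theorem im6_inj : Function.Injective im6 := by
  intro s t h
  exact_mod_cast f6_inj.image_injective h

theorem star_iff (s : Finset (Fin 60)) : IsStarSet (im6 s) ↔ s.card = 4 ∧ clq s := by
  have hc : (im6 s).ncard = s.card := by
    rw [im6, Set.ncard_image_of_injective _ f6_inj, Set.ncard_coe_finset]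
  rw [IsStarSet, hc]
  refine and_congr_right fun _ => ?_
  constructor
  · rintro ⟨-, h⟩ i hi j hj
    rw [← rep_adj, ← refl_iff]
    have hB : ∀ i, BA (vec6 (rep6 i)) (vec6 (rep6 i)) = 1 / 2 := by
      intro i; rw [BA_vec, (rep_good i).1]; norm_num
    exact h _ _ ((mem_dual _).2 ⟨_, rfl⟩) ((mem_dual _).2 ⟨_, rfl⟩) (hB i) (hB j)
      ⟨f6 i, ⟨i, hi, rfl⟩, by simp [f6, cls]⟩ ⟨f6 j, ⟨j, hj, rfl⟩, by simp [f6, cls]⟩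
  · intro h
    refine ⟨?_, ?_⟩
    · rintro _ ⟨i, -, rfl⟩
      exact (typeII_iff _).2 ⟨i, rfl⟩
    · rintro u u' hu hu' - - ⟨_, ⟨i, hi, rfl⟩, h1⟩ ⟨_, ⟨j, hj, rfl⟩, h2⟩
      obtain ⟨x, rfl⟩ := (mem_dual _).1 hu
      obtain ⟨y, rfl⟩ := (mem_dual _).1 hu'
      rw [refl_iff]
      refine adj_congr (sim_symm ((mem_cls _ _).1 h1)) (sim_symm ((mem_cls _ _).1 h2)) ?_
      rw [rep_adj]
      exact h i hi j hj

theorem sub_im (S : Set (Sym2 QA)) (h : ∀ c ∈ S, IsTypeII c) : ∃ s, S = im6 s := by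
  classical
  refine ⟨Finset.univ.filter (fun i => f6 i ∈ S), ?_⟩
  ext c
  simp only [im6, Set.mem_image, Finset.coe_filter, Finset.mem_univ, true_and, Set.mem_ofPred_eq]
  constructor
  · intro hc
    obtain ⟨i, rfl⟩ := (typeII_iff c).1 (h c hc)
    exact ⟨i, hc, rfl⟩
  · rintro ⟨i, hi, rfl⟩
    exact hi

theorem pair_iff (P : Set (Sym2 QA)) : IsPair P ↔ ∃ p : Finset (Fin 60), p.card = 2 ∧ im6 p = P := by
  constructor
  · rintro ⟨c₁, c₂, h1, h2, hne, rfl⟩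
    obtain ⟨i, rfl⟩ := (typeII_iff _).1 h1
    obtain ⟨j, rfl⟩ := (typeII_iff _).1 h2
    refine ⟨{i, j}, Finset.card_pair (fun h => hne (by rw [h])), ?_⟩
    simp [im6, Set.image_pair]
  · rintro ⟨p, hp, rfl⟩
    obtain ⟨i, j, hij, rfl⟩ := Finset.card_eq_two.1 hp
    refine ⟨f6 i, f6 j, (typeII_iff _).2 ⟨i, rfl⟩, (typeII_iff _).2 ⟨j, rfl⟩,
      fun h => hij (f6_inj h), ?_⟩
    simp [im6, Set.image_pair]

/-- common neighbours -/
def nbr (p : Finset (Fin 60)) : Finset (Fin 60) :=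
  Finset.univ.filter (fun k => (∀ i ∈ p, adjB i k = true) ∧ k ∉ p)

def cand (p : Finset (Fin 60)) : Finset (Finset (Fin 60)) :=
  if clq p then (Finset.powersetCard 2 (nbr p)).filter clq else ∅

theorem adjB_symm : ∀ i j : Fin 60, adjB i j = adjB j i := by decide +kernel

theorem nStar_eq (p : Finset (Fin 60)) (hp : p.card = 2) : nStar (im6 p) = (cand p).card := by
  have : {S : Set (Sym2 QA) | IsStarSet S ∧ im6 p ⊆ S} =
      (fun t => im6 (p ∪ t)) '' (cand p : Set (Finset (Fin 60))) := by
    ext S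
    simp only [Set.mem_ofPred_eq, Set.mem_image, Finset.mem_coe]
    constructor
    · rintro ⟨hS, hpS⟩
      obtain ⟨s, rfl⟩ := sub_im S hS.2.1
      obtain ⟨h4, hq⟩ := (star_iff s).1 hS
      have hps : p ⊆ s := by
        have := (Set.image_subset_image_iff f6_inj).1 hpS
        exact_mod_cast this
      refine ⟨s \ p, ?_, by rw [Finset.union_sdiff_of_subset hps]⟩
      have hcp : clq p := fun i hi j hj => hq i (hps hi) j (hps hj)
      rw [cand, if_pos hcp, Finset.mem_filter, Finset.mem_powersetCard]
      refine ⟨⟨?_, ?_⟩, ?_⟩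
      · intro k hk
        rw [Finset.mem_sdiff] at hk
        simp only [nbr, Finset.mem_filter, Finset.mem_univ, true_and]
        exact ⟨fun i hi => hq i (hps hi) k hk.1, hk.2⟩
      · rw [Finset.card_sdiff_of_subset hps]; omega
      · intro i hi j hj
        exact hq i (Finset.mem_sdiff.1 hi).1 j (Finset.mem_sdiff.1 hj).1
    · rintro ⟨t, ht, rfl⟩
      by_cases hcp : clq p
      · rw [cand, if_pos hcp, Finset.mem_filter, Finset.mem_powersetCard] at ht
        obtain ⟨⟨hN, h2⟩, hq⟩ := ht
        have hN' : ∀ k ∈ t, (∀ i ∈ p, adjB i k = true) ∧ k ∉ p := by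
          intro k hk
          simpa [nbr] using hN hk
        refine ⟨(star_iff _).2 ⟨?_, ?_⟩, ?_⟩
        · rw [Finset.card_union_of_disjoint, hp, h2]
          rw [Finset.disjoint_right]
          exact fun k hk => (hN' k hk).2
        · intro i hi j hj
          rcases Finset.mem_union.1 hi with hi | hi <;> rcases Finset.mem_union.1 hj with hj | hj
          · exact hcp i hi j hj
          · exact (hN' j hj).1 i hi
          · rw [adjB_symm]; exact (hN' i hi).1 j hj
          · exact hq i hi j hj
        · apply Set.image_mono
          exact_mod_cast Finset.subset_union_left
      · rw [cand, if_neg hcp] at ht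
        simp at ht
  rw [nStar, this, Set.InjOn.ncard_image, Set.ncard_coe_finset]
  intro t ht t' ht' h
  have h := im6_inj h
  have hd : ∀ t ∈ cand p, (p ∪ t) \ p = t := by
    intro t ht
    rw [cand] at ht
    split_ifs at ht
    · rw [Finset.mem_filter, Finset.mem_powersetCard] at ht
      rw [Finset.union_sdiff_left, Finset.sdiff_eq_self_iff_disjoint, Finset.disjoint_left]
      intro k hk
      have := ht.1.1 hk
      simp only [nbr, Finset.mem_filter] at this
      exact this.2.2
    · simp at ht
  rw [← hd t ht, ← hd t' ht', h]

theorem count_eq (k : ℕ) : {P : Set (Sym2 QA) | IsPair P ∧ nStar P = k}.ncard =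
    ((Finset.powersetCard 2 (Finset.univ : Finset (Fin 60))).filter
      (fun p => (cand p).card = k)).card := by
  rw [← Set.ncard_coe_finset, ← Set.ncard_image_of_injective _ im6_inj]
  congr 1
  ext P
  simp only [Set.mem_ofPred_eq, pair_iff, Set.mem_image, Finset.mem_coe, Finset.mem_filter,
    Finset.mem_powersetCard_univ]
  constructor
  · rintro ⟨⟨p, hp, rfl⟩, h⟩
    exact ⟨p, ⟨hp, by rw [← nStar_eq p hp, h]⟩, rfl⟩
  · rintro ⟨p, ⟨hp, h⟩, rfl⟩
    exact ⟨⟨p, hp, rfl⟩, by rw [nStar_eq p hp, h]⟩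

theorem total_eq : {P : Set (Sym2 QA) | IsPair P}.ncard = 1770 := by
  have : {P : Set (Sym2 QA) | IsPair P} =
      im6 '' (Finset.powersetCard 2 (Finset.univ : Finset (Fin 60)) : Set (Finset (Fin 60))) := by
    ext P
    simp [pair_iff]
  rw [this, Set.ncard_image_of_injective _ im6_inj, Set.ncard_coe_finset, Finset.card_powersetCard]
  simp
  decide

def cntLoop (q : ℕ → Bool) : ℕ → ℕ
  | 0 => 0
  | k + 1 => (bif q k then 1 else 0) + cntLoop q k

def dblLoop (r : ℕ → Bool) (q : ℕ → ℕ → Bool) : ℕ → ℕ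
  | 0 => 0
  | k + 1 => (bif r k then cntLoop (q k) k else 0) + dblLoop r q k

theorem cntLoop_eq (q : ℕ → Bool) (n : ℕ) :
    cntLoop q n = ∑ k ∈ Finset.range n, if q k = true then 1 else 0 := by
  induction n with
  | zero => rfl
  | succ n ih =>
    rw [Finset.sum_range_succ, cntLoop, ih, add_comm]
    cases q n <;> simp

theorem dblLoop_eq (r : ℕ → Bool) (q : ℕ → ℕ → Bool) (n : ℕ) :
    dblLoop r q n = ∑ k ∈ Finset.range n, ∑ l ∈ Finset.range k,
      if (r k && q k l) = true then 1 else 0 := by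
  induction n with
  | zero => rfl
  | succ n ih =>
    rw [Finset.sum_range_succ, dblLoop, ih, add_comm]
    cases h : r n <;> simp [cntLoop_eq]

set_option linter.constructorNameAsVariable false in
set_option maxRecDepth 4000 in
theorem pairs_card_s6 (F : Finset (Fin 60) → Prop) [DecidablePred F] (r : ℕ → Bool)
    (q : ℕ → ℕ → Bool)
    (hF : ∀ i j : Fin 60, j < i → (F {i, j} ↔ (r i && q i j) = true)) :
    ((Finset.powersetCard 2 (Finset.univ : Finset (Fin 60))).filter F).card =
      dblLoop r q 60 := by
  have h1 : ((Finset.univ : Finset (Fin 60 × Fin 60)).filter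
      (fun x => x.2 < x.1 ∧ (r x.1 && q x.1 x.2) = true)).card =
      ((Finset.powersetCard 2 (Finset.univ : Finset (Fin 60))).filter F).card := by
    apply Finset.card_bij (fun x _ => {x.1, x.2})
    · rintro ⟨i, j⟩ h
      simp only [Finset.mem_filter, Finset.mem_univ, true_and] at h
      simp only [Finset.mem_filter, Finset.mem_powersetCard_univ]
      exact ⟨Finset.card_pair h.1.ne', (hF i j h.1).2 h.2⟩
    · rintro ⟨i, j⟩ h ⟨i', j'⟩ h' heq
      simp only [Finset.mem_filter, Finset.mem_univ, true_and] at h h'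
      have e1 : i ∈ ({i', j'} : Finset (Fin 60)) := by rw [← heq]; simp
      have e2 : j ∈ ({i', j'} : Finset (Fin 60)) := by rw [← heq]; simp
      have e3 : i' ∈ ({i, j} : Finset (Fin 60)) := by rw [heq]; simp
      simp only [Finset.mem_insert, Finset.mem_singleton] at e1 e2 e3
      have := h.1
      have := h'.1
      rw [Prod.mk.injEq]
      omega
    · intro p hp
      simp only [Finset.mem_filter, Finset.mem_powersetCard_univ] at hp
      obtain ⟨i, j, hij, rfl⟩ := Finset.card_eq_two.1 hp.1
      rcases lt_or_gt_of_ne hij with h | h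
      · refine ⟨(j, i), ?_, Finset.pair_comm _ _⟩
        simp only [Finset.mem_filter, Finset.mem_univ, true_and]
        refine ⟨h, (hF j i h).1 ?_⟩
        rw [Finset.pair_comm]; exact hp.2
      · refine ⟨(i, j), ?_, rfl⟩
        simp only [Finset.mem_filter, Finset.mem_univ, true_and]
        exact ⟨h, (hF i j h).1 hp.2⟩
  rw [← h1, Finset.card_filter, ← Finset.univ_product_univ, Finset.sum_product, dblLoop_eq,
    ← Fin.sum_univ_eq_sum_range (fun k => ∑ l ∈ Finset.range k,
      if (r k && q k l) = true then 1 else 0) 60]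
  refine Finset.sum_congr rfl fun i _ => ?_
  simp only [Fin.lt_def]
  rw [Fin.sum_univ_eq_sum_range
    (fun l => if l < (i : ℕ) ∧ (r i && q i l) = true then 1 else 0) 60]
  have hr : Finset.range (i : ℕ) = (Finset.range 60).filter (fun l => l < (i : ℕ)) := by
    ext l
    simp only [Finset.mem_range, Finset.mem_filter]
    have := i.2
    omega
  rw [hr, Finset.sum_filter]
  refine Finset.sum_congr rfl fun l _ => ?_
  by_cases h : l < (i : ℕ) <;> simp [h]

def inN (i j k : ℕ) : Bool := adjN i k && (adjN j k && (!Nat.beq k i && !Nat.beq k j))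

def cntN (i j : ℕ) : ℕ :=
  bif adjN i j then dblLoop (inN i j) (fun k l => inN i j l && adjN k l) 60 else 0

theorem adjB_refl : ∀ i : Fin 60, adjB i i = true := by decide +kernel

theorem clq_pair (i j : Fin 60) : clq {i, j} ↔ adjN i j = true := by
  have := adjB_symm j i
  simp only [clq, Finset.mem_insert, Finset.mem_singleton, forall_eq_or_imp, forall_eq,
    adjB_refl, this, true_and, and_true, and_self]
  rfl

theorem nbr_iff (i j k : Fin 60) : k ∈ nbr {i, j} ↔ inN i j k = true := by
  have hb : ∀ a b : Fin 60, Nat.beq a b = decide (a = b) := by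
    intro a b
    rw [Bool.eq_iff_iff, Nat.beq_eq, decide_eq_true_iff, Fin.ext_iff]
  simp only [nbr, inN, Finset.mem_filter, Finset.mem_univ, true_and, Finset.mem_insert,
    Finset.mem_singleton, forall_eq_or_imp, forall_eq, not_or, hb, Bool.and_eq_true, adjB,
    Bool.not_eq_true', decide_eq_false_iff_not, and_assoc]

theorem cand_card (i j : Fin 60) : (cand {i, j}).card = cntN i j := by
  rw [cand, cntN]
  by_cases h : adjN i j = true
  · rw [if_pos ((clq_pair i j).2 h), h, cond_true,
      ← pairs_card_s6 (fun t => t ⊆ nbr {i, j} ∧ clq t)]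
    · congr 1
      ext t
      simp only [Finset.mem_filter, Finset.mem_powersetCard, Finset.subset_univ, true_and]
      tauto
    · intro k l _
      rw [clq_pair, Finset.insert_subset_iff, Finset.singleton_subset_iff, nbr_iff, nbr_iff,
        Bool.and_eq_true, Bool.and_eq_true, and_assoc]
  · rw [if_neg (fun hc => h ((clq_pair i j).1 hc)), Bool.eq_false_iff.2 h]
    rfl

theorem cnt_eq (k : ℕ) : ((Finset.powersetCard 2 (Finset.univ : Finset (Fin 60))).filter
      (fun p => (cand p).card = k)).card =
    dblLoop (fun _ => true) (fun i j => Nat.beq (cntN i j) k) 60 := by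
  apply pairs_card_s6
  intro i j _
  rw [cand_card, Bool.true_and, Nat.beq_eq]

theorem cnt0 : ((Finset.powersetCard 2 (Finset.univ : Finset (Fin 60))).filter
      (fun p => (cand p).card = 0)).card = 1320 := by
  rw [cnt_eq]; decide +kernel

theorem cnt1 : ((Finset.powersetCard 2 (Finset.univ : Finset (Fin 60))).filter
      (fun p => (cand p).card = 1)).card = 360 := by
  rw [cnt_eq]; decide +kernel

theorem cnt3 : ((Finset.powersetCard 2 (Finset.univ : Finset (Fin 60))).filter
      (fun p => (cand p).card = 3)).card = 90 := by
  rw [cnt_eq]; decide +kernel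

theorem cnt_all : ∀ p ∈ Finset.powersetCard 2 (Finset.univ : Finset (Fin 60)),
    (cand p).card = 0 ∨ (cand p).card = 1 ∨ (cand p).card = 3 := by
  rw [← Finset.card_filter_eq_iff, Finset.filter_or, Finset.filter_or,
    Finset.card_union_of_disjoint, Finset.card_union_of_disjoint, cnt0, cnt1, cnt3,
    Finset.card_powersetCard]
  · simp
    decide
  · rw [Finset.disjoint_filter]
    intros
    omega
  · rw [← Finset.filter_or, Finset.disjoint_filter]
    intros
    omega

/-- Among the 1770 unordered pairs of distinct type II classes, exactly
1320 lie in no `*`-set, exactly 360 lie in exactly one `*`-set, and the remaining 90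
lie in exactly three `*`-sets; no pair lies in exactly two or in more than three. -/
theorem statement6 :
    {P : Set (Sym2 QA) | IsPair P}.ncard = 1770 ∧
    {P : Set (Sym2 QA) | IsPair P ∧ nStar P = 0}.ncard = 1320 ∧
    {P : Set (Sym2 QA) | IsPair P ∧ nStar P = 1}.ncard = 360 ∧
    {P : Set (Sym2 QA) | IsPair P ∧ nStar P = 3}.ncard = 90 ∧
    (∀ P : Set (Sym2 QA), IsPair P → nStar P = 0 ∨ nStar P = 1 ∨ nStar P = 3) := by
  refine ⟨total_eq, (count_eq 0).trans cnt0, (count_eq 1).trans cnt1, (count_eq 3).trans cnt3, ?_⟩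
  intro P hP
  obtain ⟨p, hp, rfl⟩ := (pair_iff P).1 hP
  rw [nStar_eq p hp]
  exact cnt_all p (Finset.mem_powersetCard_univ.2 hp)

end
end

section
/- There are exactly 45 singular classes. -/
open Matrix

noncomputable section

/-- Gram matrix of the even lattice `2U(3) ⊕ A₂`. -/
def GramB : Matrix (Fin 6) (Fin 6) ℚ :=
  !![0,0,0,0,0,3; 0,0,0,0,3,0; 0,0,2,1,0,0; 0,0,1,2,0,0; 0,3,0,0,0,0; 3,0,0,0,0,0]

/-- The bilinear form on `V = ℚ⁶` with Gram matrix `GramB`. -/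
def BB (x y : Fin 6 → ℚ) : ℚ := x ⬝ᵥ GramB.mulVec y

/-- The lattice `M = ℤ⁶ ⊆ ℚ⁶`. -/
def MB : AddSubgroup (Fin 6 → ℚ) where
  carrier := {x | ∀ i, ∃ n : ℤ, x i = (n : ℚ)}
  zero_mem' := fun i => ⟨0, by simp⟩
  add_mem' := by
    intro a b ha hb i
    obtain ⟨n, hn⟩ := ha i
    obtain ⟨m, hm⟩ := hb i
    exact ⟨n + m, by simp [hn, hm]⟩
  neg_mem' := by
    intro a ha i
    obtain ⟨n, hn⟩ := ha i
    exact ⟨-n, by simp [hn]⟩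

/-- The dual lattice `M^∨ = {x ∈ V : B(x,m) ∈ ℤ for all m ∈ M}`. -/
def MBdual : Set (Fin 6 → ℚ) := {x | ∀ m ∈ MB, ∃ n : ℤ, BB x m = (n : ℚ)}

/-- The quotient `V/M` (containing the discriminant group `M^∨/M`). -/
abbrev QB := (Fin 6 → ℚ) ⧸ MB

/-- The projection `V → V/M`. -/
def pB : (Fin 6 → ℚ) → QB := QuotientAddGroup.mk

/-- A singular class: an unordered pair `{v+M, −v+M}` of cosets of order 3 in `M^∨/M`
with a representative `v` satisfying `B(v,v) = 2/3`. -/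
def IsSingular (c : Sym2 QB) : Prop :=
  ∃ v : Fin 6 → ℚ, v ∈ MBdual ∧ addOrderOf (pB v) = 3 ∧ BB v v = 2/3 ∧
    c = s(pB v, pB (-v))

/-- The reflection `σ_v(x) = x − 3·B(v,x)·v` (for `B(v,v) = 2/3`). -/
def reflB (v x : Fin 6 → ℚ) : Fin 6 → ℚ := x - (3 * BB v x) • v

/-- A `*`-set: five distinct singular classes such that `σ_v(v') ∈ (v'+M) ∪ (−v'+M)`
whenever `v, v' ∈ M^∨` have `B(v,v) = B(v',v') = 2/3` and represent cosets of
(possibly equal) classes of the set. -/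
def IsStarSetB (S : Set (Sym2 QB)) : Prop :=
  S.ncard = 5 ∧ (∀ c ∈ S, IsSingular c) ∧
  ∀ v v' : Fin 6 → ℚ, v ∈ MBdual → v' ∈ MBdual →
    BB v v = 2/3 → BB v' v' = 2/3 →
    (∃ c ∈ S, pB v ∈ c) → (∃ c' ∈ S, pB v' ∈ c') →
    (reflB v v' - v' ∈ MB ∨ reflB v v' + v' ∈ MB)

/-- Coordinates `(a,b,k,d,e)` on the discriminant group. -/
abbrev T5 := ZMod 3 × ZMod 3 × ZMod 3 × ZMod 3 × ZMod 3

def gB (a b k d e : ℤ) : Fin 6 → ℚ := ![a/3, b/3, k/3, k/3, d/3, e/3]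

def lz (x : ZMod 3) : ℤ := (ZMod.val x : ℤ)

def fB (t : T5) : QB := pB (gB (lz t.1) (lz t.2.1) (lz t.2.2.1) (lz t.2.2.2.1) (lz t.2.2.2.2))

lemma lz_cast (x : ZMod 3) : ((lz x : ℤ) : ZMod 3) = x := by
  revert x; decide

lemma pB_eq (x y : Fin 6 → ℚ) : pB x = pB y ↔ ∀ i, ∃ n : ℤ, y i - x i = n := by
  unfold pB
  rw [QuotientAddGroup.eq]
  change (∀ i, ∃ n : ℤ, (-x + y) i = (n : ℚ)) ↔ _
  simp only [Pi.add_apply, Pi.neg_apply, neg_add_eq_sub]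

lemma third (a b : ℤ) : (∃ n : ℤ, (b : ℚ)/3 - (a : ℚ)/3 = n) ↔ (a : ZMod 3) = b := by
  rw [ZMod.intCast_eq_intCast_iff_dvd_sub]
  constructor
  · rintro ⟨n, hn⟩
    refine ⟨n, ?_⟩
    have : (b : ℚ) - a = 3 * n := by linarith
    exact_mod_cast this
  · rintro ⟨n, hn⟩
    refine ⟨n, ?_⟩
    have : (b : ℚ) - a = 3 * n := by exact_mod_cast hn
    linarith

lemma pB_gB (a b k d e a' b' k' d' e' : ℤ) :
    pB (gB a b k d e) = pB (gB a' b' k' d' e') ↔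
      ((a : ZMod 3), (b : ZMod 3), (k : ZMod 3), (d : ZMod 3), (e : ZMod 3)) =
        ((a' : ZMod 3), (b' : ZMod 3), (k' : ZMod 3), (d' : ZMod 3), (e' : ZMod 3)) := by
  rw [pB_eq]
  simp only [Prod.mk.injEq, ← third]
  simp [Fin.forall_fin_succ, gB]

lemma fB_eq (a b k d e : ℤ) : fB (a, b, k, d, e) = pB (gB a b k d e) := by
  unfold fB
  rw [pB_gB]
  simp only [lz_cast]

lemma fB_inj : Function.Injective fB := by
  rintro ⟨a, b, k, d, e⟩ ⟨a', b', k', d', e'⟩ h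
  unfold fB at h
  rw [pB_gB] at h
  simpa only [lz_cast] using h

lemma BB_form (x y : Fin 6 → ℚ) : BB x y = 3 * (x 0 * y 5 + x 5 * y 0 + x 1 * y 4 + x 4 * y 1)
    + 2 * x 2 * y 2 + x 2 * y 3 + x 3 * y 2 + 2 * x 3 * y 3 := by
  simp [BB, GramB, dotProduct, Matrix.mulVec, Fin.sum_univ_succ]
  ring

/-- The norm condition modulo 3. -/
def SB : Finset T5 :=
  Finset.univ.filter fun t => t.1 * t.2.2.2.2 + t.2.1 * t.2.2.2.1 + t.2.2.1 ^ 2 = 1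

def TB : Finset (Sym2 T5) := SB.image fun t => s(t, -t)

lemma TB_card : TB.card = 45 := by
  decide +kernel

def bal (x : ZMod 3) : ℤ := if x = 0 then 0 else if x = 1 then 1 else -1

lemma bal_cast (x : ZMod 3) : ((bal x : ℤ) : ZMod 3) = x := by
  revert x; decide

lemma bal_sq (x : ZMod 3) (h : x ≠ 0) : bal x * bal x = 1 := by
  revert x; decide

lemma lift_exists (a b k d e : ZMod 3) (h : a * e + b * d + k ^ 2 = 1) :
    ∃ a' b' k' d' e' : ℤ, (a' : ZMod 3) = a ∧ (b' : ZMod 3) = b ∧ (k' : ZMod 3) = k ∧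
      (d' : ZMod 3) = d ∧ (e' : ZMod 3) = e ∧ a' * e' + b' * d' + k' ^ 2 = 1 := by
  have sq : ∀ x : ZMod 3, x ≠ 0 → x * x = 1 := by decide
  by_cases ha : a = 0
  · by_cases hb : b = 0
    · subst ha hb
      by_cases he : e = 0
      · subst he
        refine ⟨0, 0, bal k, bal d, 0, by simp, by simp, bal_cast _, bal_cast _, by simp, ?_⟩
        have : k ≠ 0 := by rintro rfl; simp at h
        linear_combination bal_sq k this
      · refine ⟨bal e * (1 - bal k ^ 2), 0, bal k, bal d, bal e, ?_, by simp, bal_cast _,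
          bal_cast _, bal_cast _, ?_⟩
        · push_cast [bal_cast]
          linear_combination -e * h
        · linear_combination (1 - bal k ^ 2) * bal_sq e he
    · refine ⟨bal a, bal b, bal k, bal b * (1 - bal k ^ 2 - bal a * bal e), bal e, bal_cast _,
        bal_cast _, bal_cast _, ?_, bal_cast _, ?_⟩
      · push_cast [bal_cast]
        linear_combination -b * h + d * sq b hb
      · linear_combination (1 - bal k ^ 2 - bal a * bal e) * bal_sq b hb
  · refine ⟨bal a, bal b, bal k, bal d, bal a * (1 - bal k ^ 2 - bal b * bal d), bal_cast _,
        bal_cast _, bal_cast _, bal_cast _, ?_, ?_⟩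
    · push_cast [bal_cast]
      linear_combination -a * h + e * sq a ha
    · linear_combination (1 - bal k ^ 2 - bal b * bal d) * bal_sq a ha

lemma gB_neg (a b k d e : ℤ) : -gB a b k d e = gB (-a) (-b) (-k) (-d) (-e) := by
  ext i
  fin_cases i <;> simp [gB] <;> ring

lemma singular_iff (c : Sym2 QB) : IsSingular c ↔ c ∈ Sym2.map fB '' (TB : Set (Sym2 T5)) := by
  constructor
  · rintro ⟨v, hv, -, hn, rfl⟩
    have hb : ∀ i : Fin 6, ∃ n : ℤ, BB v (Pi.single i 1) = n := by
      intro i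
      refine hv _ fun j => ?_
      by_cases h : j = i
      · subst h; exact ⟨1, by simp⟩
      · exact ⟨0, by simp [h]⟩
    obtain ⟨e, he⟩ := hb 0
    obtain ⟨d, hd⟩ := hb 1
    obtain ⟨m, hm⟩ := hb 2
    obtain ⟨n, hn'⟩ := hb 3
    obtain ⟨b, hb'⟩ := hb 4
    obtain ⟨a, ha⟩ := hb 5
    simp [BB_form, Pi.single_apply] at he hd hm hn' hb' ha
    have e0 : v 0 = a / 3 := by linarith
    have e1 : v 1 = b / 3 := by linarith
    have e2 : v 2 = (2 * m - n) / 3 := by linarith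
    have e3 : v 3 = (2 * n - m) / 3 := by linarith
    have e4 : v 4 = d / 3 := by linarith
    have e5 : v 5 = e / 3 := by linarith
    have hq : a * e + b * d + (m ^ 2 - m * n + n ^ 2) = 1 := by
      rw [BB_form, e0, e1, e2, e3, e4, e5] at hn
      have : (a * e + b * d + (m ^ 2 - m * n + n ^ 2) : ℚ) = 1 := by linarith
      exact_mod_cast this
    have hp : pB v = pB (gB a b (2 * m - n) d e) := by
      rw [pB_eq]
      simp only [Fin.forall_fin_succ, gB]
      simp [e0, e1, e2, e3, e4, e5]
      have h0 : ∃ n : ℤ, (0 : ℚ) = n := ⟨0, by simp⟩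
      have h1 : ∃ l : ℤ, ((2 * m - n) / 3 - (2 * n - m) / 3 : ℚ) = l :=
        ⟨m - n, by push_cast; ring⟩
      simp only [h0, h1, and_self]
    have hneg : pB (-v) = pB (-gB a b (2 * m - n) d e) := by
      change -pB v = -pB _
      rw [hp]
    refine ⟨s(((a, b, ((2 * m - n : ℤ) : ZMod 3), d, e) : T5),
      -((a, b, ((2 * m - n : ℤ) : ZMod 3), d, e) : T5)),
      ?_, ?_⟩
    · refine Finset.mem_coe.2 (Finset.mem_image.2 ⟨_, ?_, rfl⟩)
      simp only [SB, Finset.mem_filter, Finset.mem_univ, true_and]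
      have h3 : (3 : ZMod 3) = 0 := by decide
      have := congrArg (Int.cast : ℤ → ZMod 3) hq
      push_cast at this ⊢
      linear_combination this + (m ^ 2 - m * n) * h3
    · rw [Sym2.map_mk, hp, hneg, gB_neg, ← fB_eq, ← fB_eq]
      simp
  · rintro ⟨_, ht, rfl⟩
    obtain ⟨⟨a, b, k, d, e⟩, hs, rfl⟩ := Finset.mem_image.1 (Finset.mem_coe.1 ht)
    simp only [SB, Finset.mem_filter, Finset.mem_univ, true_and] at hs
    obtain ⟨a, b, k, d, e, rfl, rfl, rfl, rfl, rfl, hz⟩ := lift_exists _ _ _ _ _ hs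
    refine ⟨gB a b k d e, ?_, ?_, ?_, ?_⟩
    · intro m hm
      choose w hw using hm
      refine ⟨a * w 5 + e * w 0 + b * w 4 + d * w 1 + k * w 2 + k * w 3, ?_⟩
      rw [BB_form]
      simp [gB, hw]
      ring
    · have : Fact (Nat.Prime 3) := ⟨Nat.prime_three⟩
      have hz0 : pB (gB 0 0 0 0 0) = 0 := by
        have : gB 0 0 0 0 0 = 0 := by ext i; fin_cases i <;> simp [gB]
        rw [this]; rfl
      apply addOrderOf_eq_prime
      · have : 3 • pB (gB a b k d e) = pB (3 • gB a b k d e) := rfl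
        rw [this]
        change _ = pB 0
        rw [pB_eq]
        simp only [Fin.forall_fin_succ, gB]
        simp
        exact ⟨⟨-a, by push_cast; ring⟩, ⟨-b, by push_cast; ring⟩, ⟨-k, by push_cast; ring⟩,
          ⟨-d, by push_cast; ring⟩, ⟨-e, by push_cast; ring⟩⟩
      · rw [← hz0, Ne, pB_gB]
        intro h
        simp only [Prod.mk.injEq, Int.cast_zero] at h
        obtain ⟨h1, h2, h3, -, -⟩ := h
        rw [h1, h2, h3] at hs
        simp at hs
    · have : (a * e + b * d + k ^ 2 : ℚ) = 1 := by exact_mod_cast hz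
      rw [BB_form]
      simp [gB]
      linear_combination (2/3) * this
    · rw [Sym2.map_mk, gB_neg, ← fB_eq, ← fB_eq]
      simp

/-- There are exactly 45 singular classes. -/
theorem statement9 : {c : Sym2 QB | IsSingular c}.ncard = 45 := by
  have : {c : Sym2 QB | IsSingular c} = Sym2.map fB '' (TB : Set (Sym2 T5)) := by
    ext c
    exact singular_iff c
  rw [this, Set.ncard_image_of_injective _ (Sym2.map.injective fB_inj), Set.ncard_coe_finset,
    TB_card]

end
end
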